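/- arXiv:2503.03020 — 10 statements merged into one kernel-verified Lean document; each statement's English description precedes it below -/
import Mathlib

section
/- For every γ > 0 and every continuous function f : [0,1] → ℝ, the infimum defining the γ-exceedance fraction of order zero is attained: there exists a monotone increasing function g* : [0,1] → ℝ such that λ({x ∈ [0,1] : |f(x) − g*(x)| > γ}) = ε_{0,γ}(f). -/
open MeasureTheory Set
open scoped ENNReal

/-- The `γ`-exceedance fraction of order zero of `f` to the set of functions that are
monotone increasing on `[0,1]`. -/
noncomputable def eps0 (f : ℝ → ℝ) (γ : ℝ) : ℝ≥0∞ :=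
  ⨅ g : {g : ℝ → ℝ // MonotoneOn g (Icc 0 1)},
    volume {x ∈ Icc (0:ℝ) 1 | γ < |f x - g.1 x|}

open TopologicalSpace in
theorem upperSemicontinuous_measure_compacts {α : Type*} [TopologicalSpace α] [MeasurableSpace α]
    (μ : Measure α) [μ.OuterRegular] : UpperSemicontinuous fun K : Compacts α => μ K := by
  intro K r hr
  obtain ⟨O, hKO, hO, hOr⟩ := (K : Set α).exists_isOpen_lt_of_lt r hr
  filter_upwards [(Compacts.isOpen_subsets_of_isOpen hO).mem_nhds hKO] with L hL
  exact (measure_mono hL).trans_lt hOr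

open TopologicalSpace in
/-- Among the subsets of a compact set whose square is disjoint from a given open set,
one of maximal measure exists and can be chosen compact. -/
theorem exists_isCompact_measure_max_of_prod_disjoint {α : Type*} [TopologicalSpace α] [T2Space α]
    [MeasurableSpace α] (μ : Measure α) [μ.OuterRegular] {C : Set α} (hC : IsCompact C)
    {U : Set (α × α)} (hU : IsOpen U) :
    ∃ K ⊆ C, IsCompact K ∧ Disjoint (K ×ˢ K) U ∧
      ∀ A ⊆ C, Disjoint (A ×ˢ A) U → μ A ≤ μ K := by
  let S : Set (Compacts α) := {K | ↑K ⊆ C} ∩ {K | ↑(K ×ˢ K) ⊆ Uᶜ}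
  have hS : IsCompact S := by
    refine (Compacts.isCompact_subsets_of_isCompact hC).inter_right ?_
    exact (Compacts.isClosed_subsets_of_isClosed hU.isClosed_compl).preimage
      (Compacts.continuous_prod.comp (continuous_id.prodMk continuous_id))
  have hne : S.Nonempty := ⟨⊥, by simp [S]⟩
  obtain ⟨K, hK, hmax⟩ := UpperSemicontinuousOn.exists_isMaxOn hne hS
    ((upperSemicontinuous_measure_compacts μ).upperSemicontinuousOn S)
  refine ⟨K, hK.1, K.isCompact, ?_, fun A hAC hA => ?_⟩
  · simpa [subset_compl_iff_disjoint_right] using hK.2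
  · have hcl : closure A ⊆ C := closure_minimal hAC hC.isClosed
    refine (measure_mono subset_closure).trans
      (hmax (a := ⟨closure A, hC.of_isClosed_subset isClosed_closure hcl⟩) ⟨hcl, ?_⟩)
    have := hA.closure_left hU
    rw [closure_prod_eq] at this
    simpa [subset_compl_iff_disjoint_right] using this

/-- A function on a set that decreases by at most `2 * γ` is within `γ` of a monotone function. -/
theorem exists_monotone_abs_sub_le {α : Type*} [Preorder α] {f : α → ℝ} {γ : ℝ} {K : Set α}
    (hbdd : BddBelow (f '' K)) (hbdd' : BddAbove (f '' K))
    (h : ∀ x ∈ K, ∀ y ∈ K, x ≤ y → f x ≤ f y + 2 * γ) :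
    ∃ g : α → ℝ, Monotone g ∧ ∀ x ∈ K, |f x - g x| ≤ γ := by
  obtain ⟨m, hm⟩ := hbdd
  have hm' : ∀ x ∈ K, m ≤ f x := fun x hx => hm (mem_image_of_mem f hx)
  have hb : ∀ x, BddAbove (insert m (f '' (K ∩ Iic x))) := fun x =>
    (hbdd'.mono (image_mono inter_subset_left)).insert m
  refine ⟨fun x => sSup (insert m (f '' (K ∩ Iic x))) - γ, fun x y hxy => ?_, fun x hx => ?_⟩
  · refine sub_le_sub_right (csSup_le_csSup (hb y) (insert_nonempty _ _) ?_) γ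
    gcongr
  · have h₁ : f x ≤ sSup (insert m (f '' (K ∩ Iic x))) :=
      le_csSup (hb x) (mem_insert_of_mem _ (mem_image_of_mem f ⟨hx, le_rfl⟩))
    have h₂ : sSup (insert m (f '' (K ∩ Iic x))) ≤ f x + 2 * γ := by
      refine csSup_le (insert_nonempty _ _) ?_
      rintro _ (rfl | ⟨y, ⟨hy, hyx⟩, rfl⟩)
      · linarith [hm' x hx, h x hx x hx le_rfl]
      · exact h y hy x hx hyx
    rw [abs_le]
    constructor <;> linarith

/-- The infimum defining the `γ`-exceedance fraction of order zero is attained. -/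
theorem stmt0 (f : ℝ → ℝ) (hf : ContinuousOn f (Icc 0 1)) (γ : ℝ) (hγ : 0 < γ) :
    ∃ g : ℝ → ℝ, MonotoneOn g (Icc 0 1) ∧
      volume {x ∈ Icc (0:ℝ) 1 | γ < |f x - g x|} = eps0 f γ := by
  obtain ⟨F, hF, hFf⟩ : ∃ F : ℝ → ℝ, Continuous F ∧ EqOn F f (Icc 0 1) :=
    ⟨IccExtend zero_le_one ((Icc (0:ℝ) 1).domRestrict f), hf.domRestrict.Icc_extend',
      fun x hx => by rw [IccExtend_of_mem _ _ hx]; rfl⟩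
  have hU : IsOpen {p : ℝ × ℝ | p.1 < p.2 ∧ F p.2 + 2 * γ < F p.1} :=
    (isOpen_lt continuous_fst continuous_snd).inter
      (isOpen_lt ((hF.comp continuous_snd).add continuous_const) (hF.comp continuous_fst))
  obtain ⟨K, hK01, hK, hKU, hmax⟩ :=
    exists_isCompact_measure_max_of_prod_disjoint volume (isCompact_Icc (a := (0:ℝ)) (b := 1)) hU
  have hFK := hK.image hF
  obtain ⟨g, hg, hgK⟩ := exists_monotone_abs_sub_le (γ := γ) hFK.bddBelow hFK.bddAbove
    fun x hx y hy hxy => by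
      rcases hxy.eq_or_lt with rfl | hlt
      · linarith
      · exact not_lt.1 fun hc => disjoint_left.1 hKU (mk_mem_prod hx hy) ⟨hlt, hc⟩
  refine ⟨g, hg.monotoneOn _, le_antisymm (le_iInf fun ⟨g', hg'⟩ => ?_)
    (iInf_le (fun g : {g : ℝ → ℝ // MonotoneOn g (Icc 0 1)} =>
      volume {x ∈ Icc (0:ℝ) 1 | γ < |f x - g.1 x|}) ⟨g, hg.monotoneOn _⟩)⟩
  set B := {x ∈ Icc (0:ℝ) 1 | γ < |f x - g' x|}
  have hA : volume (Icc 0 1 \ B) ≤ volume K := by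
    refine hmax _ sdiff_subset (disjoint_left.2 ?_)
    rintro ⟨x, y⟩ ⟨⟨hx, hxB⟩, hy, hyB⟩ ⟨hlt, hc⟩
    have hx' := abs_le.1 (not_lt.1 fun h => hxB ⟨hx, h⟩)
    have hy' := abs_le.1 (not_lt.1 fun h => hyB ⟨hy, h⟩)
    have := hg' hx hy hlt.le
    simp only [hFf hx, hFf hy] at hc
    linarith [hx'.2, hy'.1]
  have hKfin : volume K ≠ ∞ := hK.measure_lt_top.ne
  calc volume {x ∈ Icc (0:ℝ) 1 | γ < |f x - g x|}
      ≤ volume (Icc 0 1 \ K) := measure_mono fun x ⟨hx, hxg⟩ =>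
        ⟨hx, fun hxK => (hFf hx ▸ hgK x hxK).not_gt hxg⟩
    _ = volume (Icc (0:ℝ) 1) - volume K :=
        measure_sdiff hK01 hK.measurableSet.nullMeasurableSet hKfin
    _ ≤ volume B := by
        rw [tsub_le_iff_right]
        calc volume (Icc (0:ℝ) 1) ≤ volume (B ∪ Icc 0 1 \ B) := measure_mono (by simp)
          _ ≤ volume B + volume (Icc 0 1 \ B) := measure_union_le _ _
          _ ≤ volume B + volume K := by gcongr
end

section
/- Let f : [0,1] → ℝ be continuous and γ > 0. Then the sets H_{f,R}(γ), H_{f,L}(γ) and H_f(γ) of γ-right-heavy, γ-left-heavy and γ-heavy points of f are Lebesgue measurable subsets of [0,1], and λ(H_f(γ)) ≥ ε_{0,γ}(f). -/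
open MeasureTheory Set
open scoped ENNReal

/-- A point `a` is `γ`-right-heavy for `f` if there is `b ∈ (a,1]` with
`λ({x ∈ [a,b] : f a - f x ≥ γ}) ≥ (b-a)/2`. -/
def RightHeavy (f : ℝ → ℝ) (γ a : ℝ) : Prop :=
  ∃ b, a < b ∧ b ≤ 1 ∧
    ENNReal.ofReal ((b - a) / 2) ≤ volume {x ∈ Icc a b | γ ≤ f a - f x}

/-- A point `a` is `γ`-left-heavy for `f` if there is `b ∈ [0,a)` with
`λ({x ∈ [b,a] : f x - f a ≥ γ}) ≥ (a-b)/2`. -/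
def LeftHeavy (f : ℝ → ℝ) (γ a : ℝ) : Prop :=
  ∃ b, 0 ≤ b ∧ b < a ∧
    ENNReal.ofReal ((a - b) / 2) ≤ volume {x ∈ Icc b a | γ ≤ f x - f a}

/-- The measure of the sections of a compact set is upper semicontinuous. -/
theorem isClosed_le_volume_section {X : Type*} [TopologicalSpace X] [T2Space X]
    {C : Set (X × ℝ)} (hC : IsCompact C) {c : X → ℝ≥0∞} (hc : Continuous c) :
    IsClosed {p | c p ≤ volume {x | (p, x) ∈ C}} := by
  rw [← isOpen_compl_iff, isOpen_iff_mem_nhds]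
  intro p hp
  have hp' : volume {x | (p, x) ∈ C} < c p := not_le.mp hp
  obtain ⟨t, ht, htc⟩ := exists_between hp'
  obtain ⟨U, hCU, hU, hUt⟩ := Set.exists_isOpen_lt_of_lt _ t ht
  have hD : IsClosed (Prod.fst '' (C ∩ Prod.snd ⁻¹' Uᶜ)) :=
    ((hC.inter_right (hU.isClosed_compl.preimage continuous_snd)).image continuous_fst).isClosed
  have hpD : p ∈ (Prod.fst '' (C ∩ Prod.snd ⁻¹' Uᶜ))ᶜ := by
    rintro ⟨⟨q, x⟩, ⟨hqC, hxU⟩, rfl⟩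
    exact hxU (hCU hqC)
  filter_upwards [hD.isOpen_compl.mem_nhds hpD, hc.continuousAt.eventually (lt_mem_nhds htc)]
    with q hq hqt
  refine not_le.mpr (lt_of_le_of_lt (measure_mono fun x hx => ?_) (hUt.trans hqt))
  by_contra hxU
  exact hq ⟨(q, x), ⟨hx, hxU⟩, rfl⟩

/-- The pairs of endpoints in `[0,1]`, at distance at least `δ`, of intervals at least half of
which satisfies `γ ≤ G p x`, form a compact set. -/
theorem isCompact_heavy_intervals {G : ℝ × ℝ → ℝ → ℝ}
    (hG : Continuous fun q : (ℝ × ℝ) × ℝ => G q.1 q.2) (γ δ : ℝ) :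
    IsCompact {p : ℝ × ℝ | p ∈ Icc (0:ℝ) 1 ×ˢ Icc (0:ℝ) 1 ∧ δ ≤ p.2 - p.1 ∧
      ENNReal.ofReal ((p.2 - p.1) / 2) ≤ volume {x ∈ Icc p.1 p.2 | γ ≤ G p x}} := by
  have hsq : IsCompact (Icc (0:ℝ) 1 ×ˢ Icc (0:ℝ) 1) := isCompact_Icc.prod isCompact_Icc
  have hC : IsCompact ((Icc (0:ℝ) 1 ×ˢ Icc (0:ℝ) 1) ×ˢ Icc (0:ℝ) 1 ∩
      {q : (ℝ × ℝ) × ℝ | q.1.1 ≤ q.2 ∧ q.2 ≤ q.1.2 ∧ γ ≤ G q.1 q.2}) :=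
    (hsq.prod isCompact_Icc).inter_right <| by
      simp only [ofPred_and]
      exact (isClosed_le (by fun_prop) (by fun_prop)).inter <|
        (isClosed_le (by fun_prop) (by fun_prop)).inter (isClosed_le continuous_const hG)
  have hcl := isClosed_le_volume_section hC (c := fun p : ℝ × ℝ =>
    ENNReal.ofReal ((p.2 - p.1) / 2)) (ENNReal.continuous_ofReal.comp (by fun_prop))
  have hδ : IsClosed {p : ℝ × ℝ | δ ≤ p.2 - p.1} := isClosed_le (by fun_prop) (by fun_prop)
  convert hsq.inter_right (hδ.inter hcl) using 1
  ext p
  simp only [mem_ofPred_eq, mem_inter_iff]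
  refine and_congr_right fun hp => and_congr_right fun _ => ?_
  have hsec : {x ∈ Icc p.1 p.2 | γ ≤ G p x} =
      {x | (p ∈ Icc (0:ℝ) 1 ×ˢ Icc (0:ℝ) 1 ∧ x ∈ Icc (0:ℝ) 1) ∧ p.1 ≤ x ∧ x ≤ p.2 ∧ γ ≤ G p x} := by
    ext x
    constructor
    · rintro ⟨⟨h1, h2⟩, h3⟩
      exact ⟨⟨hp, hp.1.1.trans h1, h2.trans hp.2.2⟩, h1, h2, h3⟩
    · rintro ⟨-, h1, h2, h3⟩
      exact ⟨⟨h1, h2⟩, h3⟩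
  rw [hsec]
  rfl

theorem measurableSet_rightHeavy {f : ℝ → ℝ} (hf : Continuous f) (γ : ℝ) :
    MeasurableSet {a ∈ Icc (0:ℝ) 1 | RightHeavy f γ a} := by
  have hK := fun n : ℕ => isCompact_heavy_intervals (G := fun p x => f p.1 - f x)
    (by fun_prop) γ (1 / ((n : ℝ) + 1))
  convert MeasurableSet.iUnion fun n => ((hK n).image continuous_fst).measurableSet using 1
  ext a
  simp only [mem_iUnion]
  constructor
  · rintro ⟨ha, b, hab, hb, h⟩
    obtain ⟨n, hn⟩ := exists_nat_one_div_lt (sub_pos.mpr hab)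
    exact ⟨n, (a, b), ⟨⟨ha, ha.1.trans hab.le, hb⟩, hn.le, h⟩, rfl⟩
  · rintro ⟨n, ⟨a, b⟩, ⟨⟨ha, hb⟩, hn, h⟩, rfl⟩
    exact ⟨ha, b, sub_pos.mp (Nat.one_div_pos_of_nat.trans_le hn), hb.2, h⟩

theorem measurableSet_leftHeavy {f : ℝ → ℝ} (hf : Continuous f) (γ : ℝ) :
    MeasurableSet {a ∈ Icc (0:ℝ) 1 | LeftHeavy f γ a} := by
  have hK := fun n : ℕ => isCompact_heavy_intervals (G := fun p x => f x - f p.2)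
    (by fun_prop) γ (1 / ((n : ℝ) + 1))
  convert MeasurableSet.iUnion fun n => ((hK n).image continuous_snd).measurableSet using 1
  ext a
  simp only [mem_iUnion]
  constructor
  · rintro ⟨ha, b, hb, hab, h⟩
    obtain ⟨n, hn⟩ := exists_nat_one_div_lt (sub_pos.mpr hab)
    exact ⟨n, (b, a), ⟨⟨⟨hb, hab.le.trans ha.2⟩, ha⟩, hn.le, h⟩, rfl⟩
  · rintro ⟨n, ⟨b, a⟩, ⟨⟨hb, ha⟩, hn, h⟩, rfl⟩
    exact ⟨ha, b, hb.1, sub_pos.mp (Nat.one_div_pos_of_nat.trans_le hn), h⟩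

theorem RightHeavy.congr {f g : ℝ → ℝ} (hfg : EqOn f g (Icc 0 1)) {γ a : ℝ}
    (ha : a ∈ Icc (0:ℝ) 1) (h : RightHeavy f γ a) : RightHeavy g γ a := by
  obtain ⟨b, hab, hb, h⟩ := h
  refine ⟨b, hab, hb, h.trans (measure_mono fun x ⟨hx, hγ⟩ => ⟨hx, ?_⟩)⟩
  rwa [← hfg ha, ← hfg ⟨ha.1.trans hx.1, hx.2.trans hb⟩]

theorem LeftHeavy.congr {f g : ℝ → ℝ} (hfg : EqOn f g (Icc 0 1)) {γ a : ℝ}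
    (ha : a ∈ Icc (0:ℝ) 1) (h : LeftHeavy f γ a) : LeftHeavy g γ a := by
  obtain ⟨b, hb, hab, h⟩ := h
  refine ⟨b, hb, hab, h.trans (measure_mono fun x ⟨hx, hγ⟩ => ⟨hx, ?_⟩)⟩
  rwa [← hfg ha, ← hfg ⟨hb.trans hx.1, hx.2.trans ha.2⟩]

/-- A drop of `2 * γ` makes one of its two endpoints heavy. -/
theorem rightHeavy_or_leftHeavy_of_drop {f : ℝ → ℝ} {γ x y : ℝ} (hx : 0 ≤ x) (hxy : x < y)
    (hy : y ≤ 1) (h : f y + 2 * γ ≤ f x) : RightHeavy f γ x ∨ LeftHeavy f γ y := by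
  by_contra! hcon
  have h1 : volume {z ∈ Icc x y | γ ≤ f x - f z} < ENNReal.ofReal ((y - x) / 2) :=
    not_le.mp fun h => hcon.1 ⟨y, hxy, hy, h⟩
  have h2 : volume {z ∈ Icc x y | γ ≤ f z - f y} < ENNReal.ofReal ((y - x) / 2) :=
    not_le.mp fun h => hcon.2 ⟨x, hx, hxy, h⟩
  have hsub : Icc x y ⊆ {z ∈ Icc x y | γ ≤ f x - f z} ∪ {z ∈ Icc x y | γ ≤ f z - f y} := by
    intro z hz
    rcases le_or_gt γ (f x - f z) with hz' | hz'
    · exact Or.inl ⟨hz, hz'⟩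
    · exact Or.inr ⟨hz, by linarith⟩
  have h3 := ((measure_mono hsub).trans (measure_union_le _ _)).trans_lt (ENNReal.add_lt_add h1 h2)
  rw [Real.volume_Icc, ← ENNReal.ofReal_add (by linarith) (by linarith), add_halves] at h3
  exact lt_irrefl _ h3

/-- A bounded function whose drops on `s` are at most `2 * γ` is within `γ` on `s` of some
monotone function. -/
theorem exists_monotone_abs_sub_le_s2 {f : ℝ → ℝ} {s : Set ℝ} {γ m M : ℝ}
    (hm : ∀ x ∈ s, m ≤ f x) (hM : ∀ x ∈ s, f x ≤ M)
    (hdrop : ∀ x ∈ s, ∀ y ∈ s, x ≤ y → f x ≤ f y + 2 * γ) (hγ : 0 ≤ γ) :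
    ∃ g : ℝ → ℝ, Monotone g ∧ ∀ x ∈ s, |f x - g x| ≤ γ := by
  have hbdd : ∀ x, BddAbove (insert m (f '' (s ∩ Iic x))) := fun x => by
    refine BddAbove.insert m ⟨M, ?_⟩
    rintro _ ⟨y, hy, rfl⟩
    exact hM y hy.1
  refine ⟨fun x => sSup (insert m (f '' (s ∩ Iic x))) - γ, fun x y hxy => ?_, fun x hx => ?_⟩
  · exact sub_le_sub_right (csSup_le_csSup (hbdd y) (insert_nonempty _ _) <|
      insert_subset_insert <| image_mono <| inter_subset_inter_right s (Iic_subset_Iic.mpr hxy)) γ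
  · have h1 : f x ≤ sSup (insert m (f '' (s ∩ Iic x))) :=
      le_csSup (hbdd x) (Or.inr ⟨x, ⟨hx, self_mem_Iic⟩, rfl⟩)
    have h2 : sSup (insert m (f '' (s ∩ Iic x))) ≤ f x + 2 * γ := by
      refine csSup_le (insert_nonempty _ _) ?_
      rintro _ (rfl | ⟨y, hy, rfl⟩)
      · linarith [hm x hx]
      · exact hdrop y hy.1 x hx hy.2
    rw [abs_le]
    constructor <;> linarith

/-- The sets of `γ`-right-heavy, `γ`-left-heavy and `γ`-heavy points of a continuous `f`
are measurable, and the set of `γ`-heavy points has measure at least `ε_{0,γ}(f)`. -/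
theorem stmt2 (f : ℝ → ℝ) (hf : ContinuousOn f (Icc 0 1)) (γ : ℝ) (hγ : 0 < γ) :
    MeasurableSet {a ∈ Icc (0:ℝ) 1 | RightHeavy f γ a} ∧
    MeasurableSet {a ∈ Icc (0:ℝ) 1 | LeftHeavy f γ a} ∧
    MeasurableSet {a ∈ Icc (0:ℝ) 1 | RightHeavy f γ a ∨ LeftHeavy f γ a} ∧
    eps0 f γ ≤ volume {a ∈ Icc (0:ℝ) 1 | RightHeavy f γ a ∨ LeftHeavy f γ a} := by
  have hF : Continuous (IccExtend zero_le_one ((Icc (0:ℝ) 1).domRestrict f)) :=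
    hf.domRestrict.Icc_extend'
  have hfF : EqOn f (IccExtend zero_le_one ((Icc (0:ℝ) 1).domRestrict f)) (Icc 0 1) :=
    fun x hx => (IccExtend_of_mem zero_le_one ((Icc (0:ℝ) 1).domRestrict f) hx).symm
  have hR : MeasurableSet {a ∈ Icc (0:ℝ) 1 | RightHeavy f γ a} := by
    convert measurableSet_rightHeavy hF γ using 1
    ext a
    exact and_congr_right fun ha => ⟨.congr hfF ha, .congr hfF.symm ha⟩
  have hL : MeasurableSet {a ∈ Icc (0:ℝ) 1 | LeftHeavy f γ a} := by
    convert measurableSet_leftHeavy hF γ using 1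
    ext a
    exact and_congr_right fun ha => ⟨.congr hfF ha, .congr hfF.symm ha⟩
  refine ⟨hR, hL, ?_, ?_⟩
  · convert hR.union hL using 1
    ext a
    exact and_or_left
  · obtain ⟨m, hm⟩ := isCompact_Icc.bddBelow_image hf
    obtain ⟨M, hM⟩ := isCompact_Icc.bddAbove_image hf
    obtain ⟨g, hg, hfg⟩ := exists_monotone_abs_sub_le_s2 (f := f) (γ := γ) (m := m) (M := M)
      (s := {a ∈ Icc (0:ℝ) 1 | ¬(RightHeavy f γ a ∨ LeftHeavy f γ a)})
      (fun x hx => hm ⟨x, hx.1, rfl⟩) (fun x hx => hM ⟨x, hx.1, rfl⟩)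
      (fun x hx y hy hxy => by
        rcases hxy.eq_or_lt with rfl | hxy
        · linarith
        · by_contra! hcon
          rcases rightHeavy_or_leftHeavy_of_drop hx.1.1 hxy hy.1.2 hcon.le with h | h
          · exact hx.2 (.inl h)
          · exact hy.2 (.inr h)) hγ.le
    refine (iInf_le _ ⟨g, hg.monotoneOn _⟩).trans (measure_mono fun x hx => ⟨hx.1, ?_⟩)
    by_contra hcon
    exact absurd hx.2 (hfg x ⟨hx.1, hcon⟩).not_gt
end

section
/- Let β ∈ (0,1], L > 0, f ∈ Σ(β,L), γ > 0 and δ > 0. If there exist 0 ≤ a < b ≤ 1 with f(a) − f(b) = 2γ + δ, then ε_{0,γ}(f) ≥ 2^{1−1/β}·(δ/L)^{1/β}. -/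
open MeasureTheory Set
open scoped ENNReal

/-- A lower bound on `u + v` from one on `u ^ β + v ^ β`, by the power mean inequality. -/
theorem two_rpow_mul_rpow_le_add {β L δ u v : ℝ} (hβ0 : 0 < β) (hβ1 : β ≤ 1) (hL : 0 < L)
    (hδ : 0 < δ) (hu : 0 ≤ u) (hv : 0 ≤ v) (h : δ ≤ L * (u ^ β + v ^ β)) :
    (2:ℝ) ^ (1 - 1/β) * (δ / L) ^ (1/β) ≤ u + v := by
  have hp : 1 ≤ 1 / β := by rwa [one_le_div hβ0]
  have hroot : ∀ w : ℝ, 0 ≤ w → (w ^ β) ^ (1/β) = w := fun w hw => by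
    rw [one_div, Real.rpow_rpow_inv hw hβ0.ne']
  have hmean : (u ^ β + v ^ β) ^ (1/β) ≤ (2:ℝ) ^ (1/β - 1) * (u + v) := by
    lift u to NNReal using hu
    lift v to NNReal using hv
    have := NNReal.rpow_add_le_mul_rpow_add_rpow (u ^ β) (v ^ β) hp
    rw [← NNReal.coe_le_coe] at this
    push_cast at this
    rwa [hroot u u.2, hroot v v.2] at this
  have hδL : δ / L ≤ u ^ β + v ^ β := by rwa [div_le_iff₀' hL]
  have hcancel : (2:ℝ) ^ (1 - 1/β) * (2:ℝ) ^ (1/β - 1) = 1 := by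
    rw [← Real.rpow_add two_pos]; simp
  calc (2:ℝ) ^ (1 - 1/β) * (δ / L) ^ (1/β)
      ≤ (2:ℝ) ^ (1 - 1/β) * ((2:ℝ) ^ (1/β - 1) * (u + v)) := by
        gcongr
        exact (Real.rpow_le_rpow (by positivity) hδL (by positivity)).trans hmean
    _ = u + v := by rw [← mul_assoc, hcancel, one_mul]

/-- If `K ≤ b - a` and `K ≤ (c - a) + (b - d)` for all points `c`, `d` of `[a, b]` outside `s`,
then `s` has measure at least `K`. -/
theorem ofReal_le_volume_of_forall_mem_diff {a b K : ℝ} {s : Set ℝ} (hK : K ≤ b - a)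
    (h : ∀ c ∈ Icc a b \ s, ∀ d ∈ Icc a b \ s, K ≤ (c - a) + (b - d)) :
    ENNReal.ofReal K ≤ volume s := by
  rcases (Icc a b \ s).eq_empty_or_nonempty with hC | hC
  · calc ENNReal.ofReal K ≤ ENNReal.ofReal (b - a) := ENNReal.ofReal_le_ofReal hK
      _ = volume (Icc a b) := Real.volume_Icc.symm
      _ ≤ volume s := measure_mono (sdiff_eq_empty.mp hC)
  · have hbelow : BddBelow (Icc a b \ s) := bddBelow_Icc.mono sdiff_subset
    have habove : BddAbove (Icc a b \ s) := bddAbove_Icc.mono sdiff_subset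
    set m := sInf (Icc a b \ s)
    set M := sSup (Icc a b \ s)
    have hmM : m ≤ M := csInf_le_csSup hC hbelow habove
    have ham : a ≤ m := le_csInf hC fun c hc => hc.1.1
    have hMb : M ≤ b := csSup_le hC fun c hc => hc.1.2
    have hKmM : K ≤ (m - a) + (b - M) := by
      have hM : M ≤ m - a + b - K := csSup_le hC fun d hd => by
        have : K + a - b + d ≤ m := le_csInf hC fun c hc => by linarith [h c hc d hd]
        linarith
      linarith
    have hdisj : Disjoint (Ico a m) (Ioc M b) :=
      disjoint_left.mpr fun x hx hx' => by linarith [hx.2, hx'.1]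
    have hsub : Ico a m ∪ Ioc M b ⊆ s := by
      rintro x (hx | hx) <;> by_contra hxs
      · have := csInf_le hbelow (⟨⟨hx.1, by linarith [hx.2]⟩, hxs⟩ : x ∈ Icc a b \ s)
        exact absurd hx.2 (not_lt.mpr this)
      · have := le_csSup habove (⟨⟨by linarith [hx.1], hx.2⟩, hxs⟩ : x ∈ Icc a b \ s)
        exact absurd hx.1 (not_lt.mpr this)
    calc ENNReal.ofReal K ≤ ENNReal.ofReal ((m - a) + (b - M)) := ENNReal.ofReal_le_ofReal hKmM
      _ = volume (Ico a m ∪ Ioc M b) := by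
        rw [measure_union hdisj measurableSet_Ioc, Real.volume_Ico, Real.volume_Ioc,
          ENNReal.ofReal_add (by linarith) (by linarith)]
      _ ≤ volume s := measure_mono hsub

/-- For Hölder `f` of order `β ∈ (0,1]`, if `f a - f b = 2γ + δ` for some `0 ≤ a < b ≤ 1`,
then `ε_{0,γ}(f) ≥ 2^{1-1/β} (δ/L)^{1/β}`. -/
theorem stmt3 (β L γ δ : ℝ) (hβ0 : 0 < β) (hβ1 : β ≤ 1) (hL : 0 < L)
    (f : ℝ → ℝ)
    (hf : ∀ x ∈ Icc (0:ℝ) 1, ∀ y ∈ Icc (0:ℝ) 1, |f x - f y| ≤ L * |x - y| ^ β)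
    (hγ : 0 < γ) (hδ : 0 < δ)
    (a b : ℝ) (ha : 0 ≤ a) (hab : a < b) (hb : b ≤ 1)
    (hfab : f a - f b = 2 * γ + δ) :
    ENNReal.ofReal ((2:ℝ) ^ (1 - 1/β) * (δ / L) ^ (1/β)) ≤ eps0 f γ := by
  have hdrop : ∀ x y, 0 ≤ x → x ≤ y → y ≤ 1 → f x - f y ≤ L * (y - x) ^ β :=
    fun x y hx hxy hy => by
      have := hf x ⟨hx, hxy.trans hy⟩ y ⟨hx.trans hxy, hy⟩
      rw [abs_sub_comm x y, abs_of_nonneg (sub_nonneg.mpr hxy)] at this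
      exact (le_abs_self _).trans this
  have hK : (2:ℝ) ^ (1 - 1/β) * (δ / L) ^ (1/β) ≤ b - a := by
    have := two_rpow_mul_rpow_le_add (u := b - a) (v := 0) hβ0 hβ1 hL hδ (by linarith) le_rfl (by
      rw [Real.zero_rpow hβ0.ne', add_zero]
      linarith [hdrop a b ha hab.le hb])
    simpa using this
  refine le_iInf fun ⟨g, hg⟩ => ofReal_le_volume_of_forall_mem_diff hK ?_
  rintro c ⟨⟨hac, hcb⟩, hc⟩ d ⟨⟨had, hdb⟩, hd⟩
  rcases le_total d c with hdc | hcd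
  · linarith
  have hc01 : c ∈ Icc (0:ℝ) 1 := ⟨ha.trans hac, hcb.trans hb⟩
  have hd01 : d ∈ Icc (0:ℝ) 1 := ⟨ha.trans had, hdb.trans hb⟩
  have hfc : |f c - g c| ≤ γ := not_lt.mp fun h => hc ⟨hc01, h⟩
  have hfd : |f d - g d| ≤ γ := not_lt.mp fun h => hd ⟨hd01, h⟩
  refine two_rpow_mul_rpow_le_add hβ0 hβ1 hL hδ (by linarith) (by linarith) ?_
  linarith [hdrop a c ha hac hc01.2, hdrop d b hd01.1 hdb hb, hg hc01 hd01 hcd,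
    (abs_le.mp hfc).2, (abs_le.mp hfd).1]
end

section
/- Let β ∈ (1,2], L > 0, f ∈ Σ(β,L), γ > 0, and δ ∈ (0,1/2] be such that D_γ(f) ∩ [δ, 1−δ] ≠ ∅, where D_γ(f) := {x ∈ [0,1] : f′(x) ≤ −γ}. Then λ({a ∈ [δ, 1−δ] : f′(x) ≤ −γ + 3Lδ^{β−1} for all x ∈ [a−δ, a+δ]}) ≥ min(ε_{1,γ}(f), 1 − 2δ). -/
open MeasureTheory Set
open scoped ENNReal

/-- If a subset `D` of `[0,1]` misses an open interval of length `2δ` inside `[δ,1-δ]`, then any set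
containing both that interval and `D ∩ [δ,1-δ]` is at least as large as `D`. -/
lemma volume_le_of_disjoint_Ioo {D T : Set ℝ} {δ u : ℝ} (hδ : 0 ≤ δ) (hD : D ⊆ Icc 0 1)
    (hDT : D ∩ Icc δ (1 - δ) ⊆ T) (huT : Ioo u (u + 2 * δ) ⊆ T)
    (hdisj : Disjoint D (Ioo u (u + 2 * δ))) : volume D ≤ volume T := by
  have hcover : D ⊆ (D ∩ Icc δ (1 - δ)) ∪ (Ico 0 δ ∪ Ioc (1 - δ) 1) := by
    intro x hx
    have h01 := hD hx
    by_cases h1 : x < δ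
    · exact Or.inr (Or.inl ⟨h01.1, h1⟩)
    by_cases h2 : 1 - δ < x
    · exact Or.inr (Or.inr ⟨h2, h01.2⟩)
    exact Or.inl ⟨hx, not_lt.1 h1, not_lt.1 h2⟩
  have hends : volume (Ico 0 δ ∪ Ioc (1 - δ) 1) ≤ volume (Ioo u (u + 2 * δ)) := by
    refine (measure_union_le _ _).trans_eq ?_
    rw [Real.volume_Ico, Real.volume_Ioc, Real.volume_Ioo,
      ← ENNReal.ofReal_add (by linarith) (by linarith)]
    congr 1
    ring
  calc volume D ≤ volume (D ∩ Icc δ (1 - δ)) + volume (Ico 0 δ ∪ Ioc (1 - δ) 1) :=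
        (measure_mono hcover).trans (measure_union_le _ _)
    _ ≤ volume (D ∩ Icc δ (1 - δ)) + volume (Ioo u (u + 2 * δ)) := by gcongr
    _ = volume ((D ∩ Icc δ (1 - δ)) ∪ Ioo u (u + 2 * δ)) :=
        (measure_union (hdisj.mono_left inter_subset_left) measurableSet_Ioo).symm
    _ ≤ volume T := measure_mono (union_subset hDT huT)

/-- The `2δ`-neighbourhood within `[δ,1-δ]` of a subset `D` of `[0,1]` that meets `[δ,1-δ]` is
either all of `[δ,1-δ]` or at least as large as `D`. -/
lemma min_volume_le_volume_neighbourhood {D : Set ℝ} {δ : ℝ} (hδ : 0 < δ) (hD : D ⊆ Icc 0 1)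
    (hne : (D ∩ Icc δ (1 - δ)).Nonempty) :
    min (volume D) (ENNReal.ofReal (1 - 2 * δ)) ≤
      volume {a ∈ Icc δ (1 - δ) | ∃ d ∈ D, |a - d| ≤ 2 * δ} := by
  set T := {a ∈ Icc δ (1 - δ) | ∃ d ∈ D, |a - d| ≤ 2 * δ}
  by_cases hall : Icc δ (1 - δ) ⊆ T
  · refine (min_le_right _ _).trans (le_trans (le_of_eq ?_) (measure_mono hall))
    rw [Real.volume_Icc]
    congr 1
    ring
  obtain ⟨p, hp, hpT⟩ := not_subset.1 hall
  have hfar : ∀ d ∈ D, 2 * δ < |p - d| := fun d hd => by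
    by_contra h
    exact hpT ⟨hp, d, hd, not_lt.1 h⟩
  have hDT : D ∩ Icc δ (1 - δ) ⊆ T := fun x hx =>
    ⟨hx.2, x, hx.1, by rw [sub_self, abs_zero]; positivity⟩
  refine (min_le_left _ _).trans ?_
  obtain ⟨c, hcD, hc⟩ := hne
  rcases le_total c p with hcp | hpc
  · have hub : ∀ d ∈ D ∩ Iic p, d ≤ p - 2 * δ := fun d hd => by
      have := hfar d hd.1
      rw [abs_of_nonneg (sub_nonneg.2 hd.2)] at this
      linarith
    have hlub : IsLUB (D ∩ Iic p) (sSup (D ∩ Iic p)) := isLUB_csSup ⟨c, hcD, hcp⟩ ⟨_, hub⟩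
    set e := sSup (D ∩ Iic p)
    have hce : c ≤ e := hlub.1 ⟨hcD, hcp⟩
    have hep : e ≤ p - 2 * δ := hlub.2 hub
    refine volume_le_of_disjoint_Ioo (u := e) hδ.le hD hDT (fun y hy => ?_) ?_
    · obtain ⟨d, hd, hyd, hde⟩ := hlub.exists_between (show y - 2 * δ < e by linarith [hy.2])
      refine ⟨⟨by linarith [hy.1, hc.1], by linarith [hy.2, hp.2]⟩, d, hd.1, ?_⟩
      rw [abs_le]
      constructor <;> linarith [hy.1]
    · refine disjoint_left.2 fun y hyD hy => ?_
      have : y ≤ e := hlub.1 ⟨hyD, mem_Iic.2 (by linarith [hy.2])⟩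
      linarith [hy.1]
  · have hlb : ∀ d ∈ D ∩ Ici p, p + 2 * δ ≤ d := fun d hd => by
      have := hfar d hd.1
      rw [abs_of_nonpos (sub_nonpos.2 hd.2)] at this
      linarith
    have hglb : IsGLB (D ∩ Ici p) (sInf (D ∩ Ici p)) := isGLB_csInf ⟨c, hcD, hpc⟩ ⟨_, hlb⟩
    set e := sInf (D ∩ Ici p)
    have hec : e ≤ c := hglb.1 ⟨hcD, hpc⟩
    have hpe : p + 2 * δ ≤ e := hglb.2 hlb
    refine volume_le_of_disjoint_Ioo (u := e - 2 * δ) hδ.le hD hDT (fun y hy => ?_) ?_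
    · rw [sub_add_cancel] at hy
      obtain ⟨d, hd, hed, hdy⟩ := hglb.exists_between (show e < y + 2 * δ by linarith [hy.1])
      refine ⟨⟨by linarith [hy.1, hp.1], by linarith [hy.2, hc.2]⟩, d, hd.1, ?_⟩
      rw [abs_le]
      constructor <;> linarith [hy.2]
    · rw [sub_add_cancel]
      refine disjoint_left.2 fun y hyD hy => ?_
      have : e ≤ y := hglb.1 ⟨hyD, mem_Ici.2 (by linarith [hy.1])⟩
      linarith [hy.2]

/-- For `f ∈ Σ(β,L)` with `β ∈ (1,2]` and `δ ∈ (0,1/2]` such that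
`D_γ(f) ∩ [δ,1-δ] ≠ ∅`, the set of `a ∈ [δ,1-δ]` with
`max_{x ∈ [a-δ,a+δ]} f'(x) ≤ -γ + 3Lδ^{β-1}` has measure at least
`min(ε_{1,γ}(f), 1-2δ)`. -/
theorem stmt4 (β L γ δ : ℝ) (hβ1 : 1 < β) (hβ2 : β ≤ 2) (hL : 0 < L)
    (f f' : ℝ → ℝ)
    (hderiv : ∀ x ∈ Icc (0:ℝ) 1, HasDerivAt f (f' x) x)
    (hf' : ∀ x ∈ Icc (0:ℝ) 1, ∀ y ∈ Icc (0:ℝ) 1,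
      |f' x - f' y| ≤ L * |x - y| ^ (β - 1))
    (hγ : 0 < γ) (hδ0 : 0 < δ) (hδ : δ ≤ 1/2)
    (hne : ({x ∈ Icc (0:ℝ) 1 | f' x ≤ -γ} ∩ Icc δ (1 - δ)).Nonempty) :
    min (volume {x ∈ Icc (0:ℝ) 1 | f' x ≤ -γ}) (ENNReal.ofReal (1 - 2 * δ)) ≤
      volume {a ∈ Icc δ (1 - δ) |
        ∀ x ∈ Icc (a - δ) (a + δ), f' x ≤ -γ + 3 * L * δ ^ (β - 1)} := by
  refine (min_volume_le_volume_neighbourhood hδ0 (sep_subset _ _) hne).trans (measure_mono ?_)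
  rintro a ⟨ha, d, ⟨hd, hdγ⟩, had⟩
  refine ⟨ha, fun x hx => ?_⟩
  have hx01 : x ∈ Icc (0:ℝ) 1 := ⟨by linarith [hx.1, ha.1], by linarith [hx.2, ha.2]⟩
  have hxd : |x - d| ≤ 3 * δ := by
    rw [abs_le] at had ⊢
    constructor <;> linarith [hx.1, hx.2, had.1, had.2]
  have hpow : |x - d| ^ (β - 1) ≤ 3 * δ ^ (β - 1) := by
    calc |x - d| ^ (β - 1) ≤ (3 * δ) ^ (β - 1) :=
          Real.rpow_le_rpow (abs_nonneg _) hxd (by linarith)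
      _ = 3 ^ (β - 1) * δ ^ (β - 1) := Real.mul_rpow (by norm_num) hδ0.le
      _ ≤ 3 * δ ^ (β - 1) := by
          gcongr
          exact Real.rpow_le_self_of_one_le (by norm_num) (by linarith)
  have hdiff := (le_abs_self _).trans (hf' x hx01 d hd)
  have := mul_le_mul_of_nonneg_left hpow hL.le
  linarith
end

section
/- Let β ∈ (1,2], L > 0, f ∈ Σ(β,L), γ > 0 and 0 < δ ≤ L. If there exists x₀ ∈ [0,1] with f′(x₀) ≤ −(γ + δ), then ε_{1,γ}(f) ≥ (δ/L)^{1/(β−1)}. -/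
open MeasureTheory Set
open scoped ENNReal

/-- For `f ∈ Σ(β,L)` with `β ∈ (1,2]`, if `f'(x₀) ≤ -(γ+δ)` at some point `x₀ ∈ [0,1]`
with `0 < δ ≤ L`, then `ε_{1,γ}(f) ≥ (δ/L)^{1/(β-1)}`. -/
theorem stmt5 (β L γ δ : ℝ) (hβ1 : 1 < β) (hβ2 : β ≤ 2) (hL : 0 < L)
    (f f' : ℝ → ℝ)
    (hderiv : ∀ x ∈ Icc (0:ℝ) 1, HasDerivAt f (f' x) x)
    (hf' : ∀ x ∈ Icc (0:ℝ) 1, ∀ y ∈ Icc (0:ℝ) 1,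
      |f' x - f' y| ≤ L * |x - y| ^ (β - 1))
    (hγ : 0 < γ) (hδ0 : 0 < δ) (hδL : δ ≤ L)
    (x₀ : ℝ) (hx₀ : x₀ ∈ Icc (0:ℝ) 1) (hx₀' : f' x₀ ≤ -(γ + δ)) :
    ENNReal.ofReal ((δ / L) ^ (1 / (β - 1))) ≤
      volume {x ∈ Icc (0:ℝ) 1 | f' x ≤ -γ} := by
  have hβ : 0 < β - 1 := by linarith
  set r := (δ / L) ^ (1 / (β - 1)) with hr
  have hr0 : 0 ≤ r := by positivity
  have hr1 : r ≤ 1 :=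
    Real.rpow_le_one (by positivity) ((div_le_one hL).2 hδL) (by positivity)
  have hrpow : L * r ^ (β - 1) = δ := by
    rw [hr, ← Real.rpow_mul (by positivity), one_div_mul_cancel hβ.ne', Real.rpow_one,
      mul_div_cancel₀ _ hL.ne']
  have hsub : Icc (max 0 (x₀ - r)) (min 1 (x₀ + r)) ⊆ {x ∈ Icc (0:ℝ) 1 | f' x ≤ -γ} := by
    rintro x ⟨hx1, hx2⟩
    rw [max_le_iff] at hx1
    rw [le_min_iff] at hx2
    have hx : x ∈ Icc (0:ℝ) 1 := ⟨hx1.1, hx2.1⟩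
    have hdist : |x - x₀| ≤ r := abs_le.2 ⟨by linarith, by linarith⟩
    have hpow : L * |x - x₀| ^ (β - 1) ≤ L * r ^ (β - 1) := by gcongr
    have hdiff := (le_abs_self _).trans (hf' x hx x₀ hx₀)
    exact ⟨hx, by linarith⟩
  have hlen : r ≤ min 1 (x₀ + r) - max 0 (x₀ - r) := by
    obtain ⟨h0, h1⟩ := hx₀
    rcases min_cases 1 (x₀ + r) with h | h <;> rcases max_cases 0 (x₀ - r) with h' | h' <;>
      linarith
  calc ENNReal.ofReal r ≤ volume (Icc (max 0 (x₀ - r)) (min 1 (x₀ + r))) := by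
        rw [Real.volume_Icc]
        exact ENNReal.ofReal_le_ofReal hlen
    _ ≤ _ := measure_mono hsub
end

section
/- Let −∞ < m ≤ M < ∞, let A be a nonempty closed subset of [m, M], and let δ > 0. Then λ(A^δ ∩ [m, M]) ≥ min(λ(A) + δ, M − m). -/
open MeasureTheory Set
open scoped ENNReal

/-- The `δ`-expansion of a set `A ⊆ ℝ`. -/
def expand (A : Set ℝ) (δ : ℝ) : Set ℝ := {x | ∃ a ∈ A, |x - a| ≤ δ}

lemma subset_expand {A : Set ℝ} {δ : ℝ} (hδ : 0 ≤ δ) : A ⊆ expand A δ :=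
  fun a ha => ⟨a, ha, by simpa using hδ⟩

/-- If an expansion within `[m, M]` contains a set of measure `δ` disjoint from `A`, its measure
exceeds that of `A` by at least `δ`. -/
lemma volume_add_le_volume_expand {A I : Set ℝ} {m M δ : ℝ} (hδ : 0 ≤ δ) (hA : A ⊆ Icc m M)
    (hI : MeasurableSet I) (hvol : volume I = ENNReal.ofReal δ) (hdisj : Disjoint A I)
    (hIA : I ⊆ expand A δ ∩ Icc m M) :
    volume A + ENNReal.ofReal δ ≤ volume (expand A δ ∩ Icc m M) := by
  rw [← hvol, ← measure_union hdisj hI]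
  exact measure_mono (union_subset (subset_inter (subset_expand hδ) hA) hIA)

/-- For a nonempty closed `A ⊆ [m,M]` and `δ > 0`,
`λ(A^δ ∩ [m,M]) ≥ min(λ(A) + δ, M - m)`. -/
theorem stmt6 (m M δ : ℝ) (hmM : m ≤ M) (A : Set ℝ) (hA : A.Nonempty)
    (hAsub : A ⊆ Icc m M) (hAc : IsClosed A) (hδ : 0 < δ) :
    min (volume A + ENNReal.ofReal δ) (ENNReal.ofReal (M - m)) ≤
      volume (expand A δ ∩ Icc m M) := by
  by_cases hcover : Icc m M ⊆ expand A δ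
  · rw [inter_eq_right.2 hcover, Real.volume_Icc]
    exact min_le_right _ _
  obtain ⟨x, hx, hxA⟩ := not_subset.1 hcover
  have hfar : ∀ a ∈ A, δ < |x - a| := fun a ha => not_le.1 fun h => hxA ⟨a, ha, h⟩
  have hcompact : IsCompact A := isCompact_Icc.of_isClosed_subset hAc hAsub
  refine (min_le_left _ _).trans ?_
  by_cases hleft : (A ∩ Iic x).Nonempty
  · obtain ⟨a, ⟨haA, hax⟩, hmax⟩ := (hcompact.inter_right isClosed_Iic).exists_isGreatest hleft
    have hδa : δ < x - a := by
      simpa [abs_of_nonneg (sub_nonneg.2 (mem_Iic.1 hax))] using hfar a haA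
    refine volume_add_le_volume_expand hδ.le hAsub (I := Ioc a (a + δ)) measurableSet_Ioc
      (by simp) (disjoint_left.2 fun y hyA hy => ?_) fun y hy => ⟨⟨a, haA, ?_⟩, ?_⟩
    · exact (hmax ⟨hyA, by simp only [mem_Iic]; linarith [hy.2]⟩).not_gt hy.1
    · rw [abs_le]
      constructor <;> linarith [hy.1, hy.2]
    · constructor <;> linarith [hy.1, hy.2, (hAsub haA).1, hx.2]
  · have hright : ∀ y ∈ A, x < y := fun y hy => not_le.1 fun h => hleft ⟨y, hy, h⟩
    obtain ⟨b, hbA, hmin⟩ := hcompact.exists_isLeast hA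
    have hδb : δ < b - x := by
      simpa [abs_of_neg (sub_neg.2 (hright b hbA))] using hfar b hbA
    refine volume_add_le_volume_expand hδ.le hAsub (I := Ico (b - δ) b) measurableSet_Ico
      (by simp) (disjoint_left.2 fun y hyA hy => ?_) fun y hy => ⟨⟨b, hbA, ?_⟩, ?_⟩
    · exact (hmin hyA).not_gt hy.2
    · rw [abs_le]
      constructor <;> linarith [hy.1, hy.2]
    · constructor <;> linarith [hy.1, hy.2, (hAsub hbA).2, hx.1]
end

section
/- Let n ≥ 1 and 1 ≤ i ≤ j ≤ n be integers, and let A be a nonempty Lebesgue measurable subset of [0,1]. Let K be a random variable uniformly distributed on the finite set {i, i+1, …, j} and set I := K/n. Then P(I ∈ A^{1/n}) ≥ (n/(j−i+1)) · λ(A ∩ [(i−1)/n, j/n]). -/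
open MeasureTheory Set
open scoped ENNReal

/-- Every point of `[(i-1)/n, j/n]` lies in a cell `[(k-1)/n, k/n]` with `i ≤ k ≤ j`. -/
lemma exists_mem_Icc_cell {n i j : ℕ} (hn : 0 < n) (hij : i ≤ j) {a : ℝ}
    (ha : a ∈ Icc (((i : ℝ) - 1) / n) ((j : ℝ) / n)) :
    ∃ k ∈ Finset.Icc i j, a ∈ Icc (((k : ℝ) - 1) / n) ((k : ℝ) / n) := by
  have hn' : (0 : ℝ) < n := by exact_mod_cast hn
  obtain ⟨h₁, h₂⟩ := ha
  rw [div_le_iff₀ hn'] at h₁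
  rw [le_div_iff₀ hn'] at h₂
  refine ⟨max i ⌈a * n⌉₊, Finset.mem_Icc.2
    ⟨le_max_left _ _, max_le hij (Nat.ceil_le.2 h₂)⟩, ?_, ?_⟩
  · rw [div_le_iff₀ hn']
    rcases le_total ⌈a * n⌉₊ i with h | h
    · rwa [max_eq_left h]
    · rw [max_eq_right h]
      rcases Nat.eq_zero_or_pos ⌈a * n⌉₊ with h0 | h0
      · rwa [h0, ← Nat.le_zero.1 (h0 ▸ h)]
      · linarith [Nat.ceil_lt_add_one (Nat.ceil_pos.1 h0).le]
  · rw [le_div_iff₀ hn']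
    exact (Nat.le_ceil _).trans (by exact_mod_cast le_max_right _ _)

/-- The part of `A` in `[(i-1)/n, j/n]` has measure at most `1/n` times the number of
`k ∈ {i, …, j}` such that `k/n` lies in the `1/n`-expansion of `A`. -/
lemma volume_inter_Icc_le_card_expand {n i j : ℕ} (hn : 0 < n) (hij : i ≤ j) (A : Set ℝ)
    {S : Finset ℕ} (hS : ∀ k ∈ Finset.Icc i j, (k : ℝ) / n ∈ expand A (1 / n) → k ∈ S) :
    volume (A ∩ Icc (((i : ℝ) - 1) / n) ((j : ℝ) / n)) ≤ (S.card : ℝ≥0∞) * (n : ℝ≥0∞)⁻¹ := by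
  have hn' : (0 : ℝ) < n := by exact_mod_cast hn
  have hcover : A ∩ Icc (((i : ℝ) - 1) / n) ((j : ℝ) / n) ⊆
      ⋃ k ∈ S, Icc (((k : ℝ) - 1) / n) ((k : ℝ) / n) := by
    rintro a ⟨haA, ha⟩
    obtain ⟨k, hk, hak⟩ := exists_mem_Icc_cell hn hij ha
    refine mem_biUnion (hS k hk ⟨a, haA, ?_⟩) hak
    rw [mem_Icc, sub_div] at hak
    rw [abs_le]
    constructor <;> linarith [hak.1, hak.2, one_div_pos.2 hn']
  have hcell (k : ℕ) : volume (Icc (((k : ℝ) - 1) / n) ((k : ℝ) / n)) = (n : ℝ≥0∞)⁻¹ := by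
    rw [Real.volume_Icc, ← sub_div, sub_sub_cancel, one_div, ENNReal.ofReal_inv_of_pos hn',
      ENNReal.ofReal_natCast]
  calc _ ≤ ∑ k ∈ S, volume (Icc (((k : ℝ) - 1) / n) ((k : ℝ) / n)) :=
        (measure_mono hcover).trans (measure_biUnion_finset_le _ _)
    _ = _ := by simp [hcell]

/-- If `K` is uniformly distributed on `{i, …, j}` and `I = K/n`, then
`P(I ∈ A^{1/n}) ≥ (n/(j-i+1)) λ(A ∩ [(i-1)/n, j/n])`. -/
theorem stmt7 (n i j : ℕ) (hn : 1 ≤ n) (hi : 1 ≤ i) (hij : i ≤ j) (hj : j ≤ n)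
    (A : Set ℝ) (hA : A.Nonempty) (hAm : MeasurableSet A) (hAsub : A ⊆ Icc 0 1)
    {Ω : Type*} [MeasurableSpace Ω] (P : Measure Ω) [IsProbabilityMeasure P]
    (K : Ω → ℕ) (hK : Measurable K)
    (hunif : ∀ k : ℕ, P {ω | K ω = k} =
      if i ≤ k ∧ k ≤ j then (((j - i + 1 : ℕ) : ℝ≥0∞))⁻¹ else 0) :
    (n : ℝ≥0∞) / ((j - i + 1 : ℕ) : ℝ≥0∞) *
        volume (A ∩ Icc (((i : ℝ) - 1) / n) ((j : ℝ) / n)) ≤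
      P {ω | ((K ω : ℝ) / n) ∈ expand A (1 / n)} := by
  classical
  set S := (Finset.Icc i j).filter fun k : ℕ => (k : ℝ) / n ∈ expand A (1 / n)
  have hvol : volume (A ∩ Icc (((i : ℝ) - 1) / n) ((j : ℝ) / n)) ≤
      (S.card : ℝ≥0∞) * (n : ℝ≥0∞)⁻¹ :=
    volume_inter_Icc_le_card_expand hn hij A fun k hk h => Finset.mem_filter.2 ⟨hk, h⟩
  have hprob : P (K ⁻¹' S) = S.card * (((j - i + 1 : ℕ) : ℝ≥0∞))⁻¹ := by
    rw [← sum_measure_preimage_singleton S fun k _ => hK (measurableSet_singleton k),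
      ← nsmul_eq_mul]
    refine Finset.sum_eq_card_nsmul fun k hk => ?_
    exact (hunif k).trans (if_pos (Finset.mem_Icc.1 (Finset.mem_filter.1 hk).1))
  have hn0 : (n : ℝ≥0∞) ≠ 0 := Nat.cast_ne_zero.2 (by omega)
  calc _ ≤ (n : ℝ≥0∞) / ((j - i + 1 : ℕ) : ℝ≥0∞) * (S.card * (n : ℝ≥0∞)⁻¹) := by gcongr
    _ = (n : ℝ≥0∞) * (n : ℝ≥0∞)⁻¹ * (S.card * (((j - i + 1 : ℕ) : ℝ≥0∞))⁻¹) := by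
        rw [div_eq_mul_inv]; ring
    _ = P (K ⁻¹' S) := by
        rw [ENNReal.mul_inv_cancel hn0 (ENNReal.natCast_ne_top n), one_mul, hprob]
    _ ≤ _ := measure_mono fun ω (hω : K ω ∈ S) => (Finset.mem_filter.1 hω).2
end

section
/- Let (X,d) be a metric space, let M ≥ 1 be an integer, let x, x_1, …, x_M ∈ X, let G₂ : {1,…,M} → (0,∞) be nonincreasing, and let κ > 1. Call a nondecreasing function G₁ : {1,…,M} → [0,∞) admissible for x if d(x, x_m) ≤ G₁(m) + G₂(m) for all m ∈ {1,…,M} and G₁(1) ≤ G₂(1). Assume at least one admissible function exists. Define m* := max{ m ∈ {1,…,M} : there exists an admissible G₁ with G₁(m) ≤ G₂(m) } and m̄ := min{ m ∈ {1,…,M} : there exists k ∈ {1,…,m−1} with d(x_k, x_m) > 4κ·G₂(k) } − 1, with the convention m̄ := M if no such m exists. Then d(x, x_{m̄}) ≤ 6κ·G₂(m*). If in addition there exists D ≥ 1 with G₂(m) ≤ D·G₂(m+1) for all m ∈ {1,…,M−1}, then d(x, x_{m̄}) ≤ 6κD · inf{ G₁(m) + κ·G₂(m) : m ∈ {1,…,M},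 G₁ admissible for x }. -/
/-- `G₁` is admissible for `x` (relative to approximants `xs`, error bound `G₂` and
horizon `M`): `G₁` is nonnegative and nondecreasing on `{1,…,M}`,
`d(x, x_m) ≤ G₁(m) + G₂(m)` for all `m ∈ {1,…,M}`, and `G₁(1) ≤ G₂(1)`. -/
def Admissible {X : Type*} [MetricSpace X] (M : ℕ) (x : X) (xs : ℕ → X)
    (G₂ G₁ : ℕ → ℝ) : Prop :=
  (∀ m, 1 ≤ m → m ≤ M → 0 ≤ G₁ m) ∧
  (∀ k m, 1 ≤ k → k ≤ m → m ≤ M → G₁ k ≤ G₁ m) ∧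
  (∀ m, 1 ≤ m → m ≤ M → dist x (xs m) ≤ G₁ m + G₂ m) ∧
  G₁ 1 ≤ G₂ 1

/-- The deterministic oracle form of the Lepskii balancing principle. -/
theorem stmt11 {X : Type*} [MetricSpace X] (M : ℕ) (hM : 1 ≤ M)
    (x : X) (xs : ℕ → X) (G₂ : ℕ → ℝ)
    (hG₂pos : ∀ m, 1 ≤ m → m ≤ M → 0 < G₂ m)
    (hG₂anti : ∀ k m, 1 ≤ k → k ≤ m → m ≤ M → G₂ m ≤ G₂ k)
    (κ : ℝ) (hκ : 1 < κ)
    (hexists : ∃ G₁, Admissible M x xs G₂ G₁)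
    (mstar : ℕ) (hmstar1 : 1 ≤ mstar) (hmstarM : mstar ≤ M)
    (hmstar_mem : ∃ G₁, Admissible M x xs G₂ G₁ ∧ G₁ mstar ≤ G₂ mstar)
    (hmstar_max : ∀ m, 1 ≤ m → m ≤ M →
      (∃ G₁, Admissible M x xs G₂ G₁ ∧ G₁ m ≤ G₂ m) → m ≤ mstar)
    (Bad : Set ℕ)
    (hBad : Bad = {m | 1 ≤ m ∧ m ≤ M ∧
      ∃ k, 1 ≤ k ∧ k < m ∧ 4 * κ * G₂ k < dist (xs k) (xs m)})
    (mbar : ℕ)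
    (hmbar : (Bad = ∅ ∧ mbar = M) ∨ (mbar + 1 ∈ Bad ∧ ∀ m ∈ Bad, mbar + 1 ≤ m)) :
    dist x (xs mbar) ≤ 6 * κ * G₂ mstar ∧
    (∀ D : ℝ, 1 ≤ D → (∀ m, 1 ≤ m → m < M → G₂ m ≤ D * G₂ (m + 1)) →
      ∀ G₁, Admissible M x xs G₂ G₁ → ∀ m, 1 ≤ m → m ≤ M →
        dist x (xs mbar) ≤ 6 * κ * D * (G₁ m + κ * G₂ m)) := by
  obtain ⟨G, ⟨-, hGmono, hGdist, -⟩, hGstar⟩ := hmstar_mem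
  have hpos := hG₂pos mstar hmstar1 hmstarM
  have lt_of_mem_bad : ∀ m ∈ Bad, mstar < m := by
    intro m hm
    rw [hBad] at hm
    obtain ⟨h1, hmM, k, hk1, hkm, hlt⟩ := hm
    by_contra! hle
    have htri := dist_triangle_left (xs k) (xs m) x
    have hdk := hGdist k hk1 (by lia)
    have hdm := hGdist m h1 hmM
    have hGk := hGmono k m hk1 hkm.le hmM
    have hGm := hGmono m mstar h1 hle hmstarM
    have hG₂m := hG₂anti m mstar h1 hle hmstarM
    have hG₂k := hG₂anti k m hk1 hkm.le hmM
    have hk0 := hG₂pos k hk1 (by lia)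
    nlinarith
  have hbar : mstar ≤ mbar ∧ mbar ≤ M ∧ mbar ∉ Bad := by
    rcases hmbar with ⟨he, rfl⟩ | ⟨hmem, hmin⟩
    · simp [he, hmstarM]
    · refine ⟨Nat.lt_succ_iff.mp (lt_of_mem_bad _ hmem), ?_, fun h => ?_⟩
      · rw [hBad] at hmem
        have := hmem.2.1
        lia
      · have := hmin _ h
        lia
  obtain ⟨hsb, hbM, hbar_good⟩ := hbar
  have hbal : dist (xs mstar) (xs mbar) ≤ 4 * κ * G₂ mstar := by
    rcases hsb.eq_or_lt with rfl | hlt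
    · rw [dist_self]
      positivity
    · by_contra! hfar
      refine hbar_good ?_
      rw [hBad]
      exact ⟨by lia, hbM, mstar, hmstar1, hlt, hfar⟩
  have hmain : dist x (xs mbar) ≤ 6 * κ * G₂ mstar := by
    have htri := dist_triangle x (xs mstar) (xs mbar)
    have hds := hGdist mstar hmstar1 hmstarM
    nlinarith
  refine ⟨hmain, fun D hD hDG G₁ hG₁ m hm1 hmM => ?_⟩
  suffices h : G₂ mstar ≤ D * (G₁ m + κ * G₂ m) by
    calc dist x (xs mbar) ≤ 6 * κ * G₂ mstar := hmain
      _ ≤ 6 * κ * (D * (G₁ m + κ * G₂ m)) := by gcongr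
      _ = 6 * κ * D * (G₁ m + κ * G₂ m) := by ring
  have hG₁0 := hG₁.1 m hm1 hmM
  have hG₂0 := hG₂pos m hm1 hmM
  rcases le_or_gt m mstar with hle | hlt
  · have hanti := hG₂anti m mstar hm1 hle hmstarM
    have hκG : G₂ m ≤ κ * G₂ m := le_mul_of_one_le_left hG₂0.le hκ.le
    have hDG' : G₁ m + κ * G₂ m ≤ D * (G₁ m + κ * G₂ m) :=
      le_mul_of_one_le_left (by positivity) hD
    linarith
  · have hnext : G₂ (mstar + 1) < G₁ (mstar + 1) := by
      by_contra! hle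
      have := hmstar_max (mstar + 1) (by lia) (by lia) ⟨G₁, hG₁, hle⟩
      lia
    have hmono := hG₁.2.1 (mstar + 1) m (by lia) hlt hmM
    have hκG : 0 ≤ κ * G₂ m := by positivity
    calc G₂ mstar ≤ D * G₂ (mstar + 1) := hDG mstar hmstar1 (by lia)
      _ ≤ D * (G₁ m + κ * G₂ m) := by
        gcongr
        linarith
end

section
/- Let β ∈ (0,1], L > 0, and let f ∈ Σ(β,L) be monotone increasing. Let K : ℝ → ℝ satisfy K ≥ 0 and K(u) = 0 for |u| ≥ 1, let n ≥ 1, h > 0, design points x_k = k/n, and let a, b ∈ [0,1] with a < b be such that Σ_{j=1}^n K((x_j − a)/h) > 0 and Σ_{j=1}^n K((x_j − b)/h) > 0. Then Σ_{k=1}^n w_k(a) f(x_k) − Σ_{k=1}^n w_k(b) f(x_k) ≤ 2L·h^β, where w_k denote the Nadaraya–Watson weights. -/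
open Set

/-- The Nadaraya–Watson smoother of a Hölder function has bias at most `L * h ^ β`. -/
lemma abs_nadarayaWatson_sub_le {β L : ℝ} (hβ0 : 0 ≤ β) (hL : 0 ≤ L) {f : ℝ → ℝ}
    (hfH : ∀ x ∈ Icc (0:ℝ) 1, ∀ y ∈ Icc (0:ℝ) 1, |f x - f y| ≤ L * |x - y| ^ β)
    {K : ℝ → ℝ} (hK0 : ∀ u, 0 ≤ K u) (hsupp : ∀ u : ℝ, 1 ≤ |u| → K u = 0)
    {n : ℕ} {h : ℝ} (hh : 0 < h) {x : ℝ} (hx : x ∈ Icc (0:ℝ) 1)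
    (hS : 0 < ∑ j ∈ Finset.Icc 1 n, K (((j : ℝ) / n - x) / h)) :
    |(∑ k ∈ Finset.Icc 1 n,
        (K (((k : ℝ) / n - x) / h) /
          ∑ j ∈ Finset.Icc 1 n, K (((j : ℝ) / n - x) / h)) * f ((k : ℝ) / n)) - f x| ≤
      L * h ^ β := by
  set S := ∑ j ∈ Finset.Icc 1 n, K (((j : ℝ) / n - x) / h) with hSdef
  have hw : ∑ k ∈ Finset.Icc 1 n, K (((k : ℝ) / n - x) / h) / S = 1 := by
    rw [← Finset.sum_div, ← hSdef, div_self hS.ne']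
  calc
    _ = |∑ k ∈ Finset.Icc 1 n,
          (K (((k : ℝ) / n - x) / h) / S) * (f ((k : ℝ) / n) - f x)| := by
      simp only [mul_sub, Finset.sum_sub_distrib, ← Finset.sum_mul, hw, one_mul]
    _ ≤ ∑ k ∈ Finset.Icc 1 n,
          |(K (((k : ℝ) / n - x) / h) / S) * (f ((k : ℝ) / n) - f x)| :=
      Finset.abs_sum_le_sum_abs _ _
    _ ≤ ∑ k ∈ Finset.Icc 1 n, (K (((k : ℝ) / n - x) / h) / S) * (L * h ^ β) := by
      refine Finset.sum_le_sum fun k hk => ?_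
      have hw0 : 0 ≤ K (((k : ℝ) / n - x) / h) / S := div_nonneg (hK0 _) hS.le
      rw [abs_mul, abs_of_nonneg hw0]
      rcases le_or_gt 1 |((k : ℝ) / n - x) / h| with hu | hu
      · simp [hsupp _ hu]
      · have hkn : (k : ℝ) / n ∈ Icc (0:ℝ) 1 :=
          ⟨by positivity, div_le_one_of_le₀ (mod_cast (Finset.mem_Icc.1 hk).2) (by positivity)⟩
        rw [abs_div, abs_of_pos hh, div_lt_one hh] at hu
        refine mul_le_mul_of_nonneg_left ((hfH _ hkn x hx).trans ?_) hw0
        gcongr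
    _ = L * h ^ β := by rw [← Finset.sum_mul, hw, one_mul]

/-- For a monotone increasing `f ∈ Σ(β,L)` with `β ∈ (0,1]`, the difference of the
Nadaraya–Watson smoothers at `a < b` is at most `2Lh^β`. -/
theorem stmt14 (β L : ℝ) (hβ0 : 0 < β) (hβ1 : β ≤ 1) (hL : 0 < L)
    (f : ℝ → ℝ)
    (hfH : ∀ x ∈ Icc (0:ℝ) 1, ∀ y ∈ Icc (0:ℝ) 1, |f x - f y| ≤ L * |x - y| ^ β)
    (hfmono : MonotoneOn f (Icc 0 1))
    (K : ℝ → ℝ) (hK0 : ∀ u, 0 ≤ K u) (hsupp : ∀ u : ℝ, 1 ≤ |u| → K u = 0)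
    (n : ℕ) (hn : 1 ≤ n) (h : ℝ) (hh : 0 < h)
    (a b : ℝ) (ha : a ∈ Icc (0:ℝ) 1) (hb : b ∈ Icc (0:ℝ) 1) (hab : a < b)
    (hSa : 0 < ∑ j ∈ Finset.Icc 1 n, K (((j : ℝ) / n - a) / h))
    (hSb : 0 < ∑ j ∈ Finset.Icc 1 n, K (((j : ℝ) / n - b) / h)) :
    (∑ k ∈ Finset.Icc 1 n,
        (K (((k : ℝ) / n - a) / h) /
          ∑ j ∈ Finset.Icc 1 n, K (((j : ℝ) / n - a) / h)) * f ((k : ℝ) / n)) -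
      (∑ k ∈ Finset.Icc 1 n,
        (K (((k : ℝ) / n - b) / h) /
          ∑ j ∈ Finset.Icc 1 n, K (((j : ℝ) / n - b) / h)) * f ((k : ℝ) / n)) ≤
    2 * L * h ^ β := by
  have hA := abs_le.1 (abs_nadarayaWatson_sub_le hβ0.le hL.le hfH hK0 hsupp hh ha hSa)
  have hB := abs_le.1 (abs_nadarayaWatson_sub_le hβ0.le hL.le hfH hK0 hsupp hh hb hSb)
  linarith [hA.2, hB.1, hfmono ha hb hab.le]
end

section
/- Let f : [0,1] → ℝ be monotone increasing. Let K : ℝ → ℝ satisfy K ≥ 0 and K(u) = 0 for |u| ≥ 1, let n ≥ 1, h > 0, design points x_k = k/n, and let i < j in {1,…,n} satisfy h ≤ x_i and x_j ≤ 1 − h, with Σ_{l=1}^n K((x_l − x_i)/h) > 0. Then Σ_{l=1}^n K((x_l − x_j)/h) = Σ_{l=1}^n K((x_l − x_i)/h) > 0 and Σ_{k=1}^n w_k(x_i) f(x_k) ≤ Σ_{k=1}^n w_k(x_j) f(x_k), where w_k denote the Nadaraya–Watson weights. -/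
open Set

/-- A kernel weight vanishes as soon as the two design points are at distance at least `h`. -/
lemma kernel_eq_zero_of_le_abs {K : ℝ → ℝ} (hsupp : ∀ u : ℝ, 1 ≤ |u| → K u = 0)
    {h : ℝ} (hh : 0 < h) {t : ℝ} (ht : h ≤ |t|) : K (t / h) = 0 := by
  apply hsupp
  rw [abs_div, abs_of_pos hh]
  exact (one_le_div hh).2 ht

/-- Below the shift `j - i`, the weights centred at `j / n` vanish. -/
lemma kernel_eq_zero_of_add_le {K : ℝ → ℝ} (hsupp : ∀ u : ℝ, 1 ≤ |u| → K u = 0)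
    {h : ℝ} (hh : 0 < h) {n i j k : ℕ} (hhi : h ≤ (i : ℝ) / n) (hk : k + i ≤ j) :
    K (((k : ℝ) / n - (j : ℝ) / n) / h) = 0 := by
  apply kernel_eq_zero_of_le_abs hsupp hh
  have hkR : (k : ℝ) + i ≤ j := by exact_mod_cast hk
  have hdiv : ((k : ℝ) + i) / n ≤ (j : ℝ) / n := by gcongr
  rw [add_div] at hdiv
  rw [abs_sub_comm]
  exact le_trans (by linarith) (le_abs_self _)

/-- Above `n - (j - i)`, the weights centred at `i / n` vanish. -/
lemma kernel_eq_zero_of_le_add {K : ℝ → ℝ} (hsupp : ∀ u : ℝ, 1 ≤ |u| → K u = 0)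
    {h : ℝ} (hh : 0 < h) {n i j k : ℕ} (hn : 1 ≤ n) (hhj : (j : ℝ) / n ≤ 1 - h)
    (hk : n + i ≤ k + j) :
    K (((k : ℝ) / n - (i : ℝ) / n) / h) = 0 := by
  apply kernel_eq_zero_of_le_abs hsupp hh
  have hn0 : (n : ℝ) ≠ 0 := by positivity
  have hkR : (n : ℝ) + i ≤ k + j := by exact_mod_cast hk
  have hdiv : ((n : ℝ) + i) / n ≤ ((k : ℝ) + j) / n := by gcongr
  rw [add_div, add_div, div_self hn0] at hdiv
  exact le_trans (by linarith) (le_abs_self _)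

/-- Weighted sums centred at interior design points are translates of each other. -/
lemma sum_kernel_shift {K : ℝ → ℝ} (hsupp : ∀ u : ℝ, 1 ≤ |u| → K u = 0)
    {h : ℝ} (hh : 0 < h) {n i j : ℕ} (hn : 1 ≤ n) (hij : i ≤ j)
    (hhi : h ≤ (i : ℝ) / n) (hhj : (j : ℝ) / n ≤ 1 - h) (g : ℕ → ℝ) :
    ∑ k ∈ Finset.Icc 1 n, K (((k : ℝ) / n - (i : ℝ) / n) / h) * g k =
      ∑ k ∈ Finset.Icc 1 n, K (((k : ℝ) / n - (j : ℝ) / n) / h) * g (k - (j - i)) := by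
  have hshift : ∀ k : ℕ, ((k + (j - i) : ℕ) : ℝ) / n - (j : ℝ) / n =
      (k : ℝ) / n - (i : ℝ) / n := by
    intro k
    push_cast [Nat.cast_sub hij]
    ring
  refine Finset.sum_bij_ne_zero (fun k _ _ => k + (j - i)) ?_ ?_ ?_ ?_
  · intro k hk hne
    rw [Finset.mem_Icc] at hk ⊢
    by_contra hcon
    exact hne (by rw [kernel_eq_zero_of_le_add hsupp hh hn hhj (by omega), zero_mul])
  · intro a _ _ b _ _ hab
    exact Nat.add_right_cancel hab
  · intro k hk hne
    rw [Finset.mem_Icc] at hk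
    have hlt : j < k + i := by
      by_contra hcon
      exact hne (by rw [kernel_eq_zero_of_add_le hsupp hh hhi (by omega), zero_mul])
    have hk' : k - (j - i) + (j - i) = k := by omega
    refine ⟨k - (j - i), Finset.mem_Icc.2 (by omega), ?_, hk'⟩
    rwa [← hshift, hk']
  · intro k _ _
    rw [hshift, Nat.add_sub_cancel]

/-- For a monotone increasing `f` and interior design points `x_i < x_j` in `[h, 1-h]`,
the kernel normalisations coincide and the Nadaraya–Watson smoother is ordered:
`∑ w_k(x_i) f(x_k) ≤ ∑ w_k(x_j) f(x_k)`. -/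
theorem stmt15 (f : ℝ → ℝ) (hfmono : MonotoneOn f (Icc 0 1))
    (K : ℝ → ℝ) (hK0 : ∀ u, 0 ≤ K u) (hsupp : ∀ u : ℝ, 1 ≤ |u| → K u = 0)
    (n : ℕ) (hn : 1 ≤ n) (h : ℝ) (hh : 0 < h)
    (i j : ℕ) (hi : 1 ≤ i) (hij : i < j) (hj : j ≤ n)
    (hhi : h ≤ (i : ℝ) / n) (hhj : (j : ℝ) / n ≤ 1 - h)
    (hSi : 0 < ∑ l ∈ Finset.Icc 1 n, K (((l : ℝ) / n - (i : ℝ) / n) / h)) :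
    (∑ l ∈ Finset.Icc 1 n, K (((l : ℝ) / n - (j : ℝ) / n) / h) =
      ∑ l ∈ Finset.Icc 1 n, K (((l : ℝ) / n - (i : ℝ) / n) / h)) ∧
    (0 < ∑ l ∈ Finset.Icc 1 n, K (((l : ℝ) / n - (j : ℝ) / n) / h)) ∧
    (∑ k ∈ Finset.Icc 1 n,
        (K (((k : ℝ) / n - (i : ℝ) / n) / h) /
          ∑ l ∈ Finset.Icc 1 n, K (((l : ℝ) / n - (i : ℝ) / n) / h)) * f ((k : ℝ) / n)
      ≤ ∑ k ∈ Finset.Icc 1 n,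
        (K (((k : ℝ) / n - (j : ℝ) / n) / h) /
          ∑ l ∈ Finset.Icc 1 n, K (((l : ℝ) / n - (j : ℝ) / n) / h)) * f ((k : ℝ) / n)) := by
  have hsum : ∑ l ∈ Finset.Icc 1 n, K (((l : ℝ) / n - (j : ℝ) / n) / h) =
      ∑ l ∈ Finset.Icc 1 n, K (((l : ℝ) / n - (i : ℝ) / n) / h) := by
    simpa using (sum_kernel_shift hsupp hh hn hij.le hhi hhj (fun _ => 1)).symm
  refine ⟨hsum, hsum ▸ hSi, ?_⟩
  rw [hsum]
  simp only [div_mul_eq_mul_div]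
  rw [← Finset.sum_div, ← Finset.sum_div]
  refine div_le_div_of_nonneg_right ?_ hSi.le
  rw [sum_kernel_shift hsupp hh hn hij.le hhi hhj (fun k => f ((k : ℝ) / n))]
  refine Finset.sum_le_sum fun k hk => mul_le_mul_of_nonneg_left ?_ (hK0 _)
  have hunit : ∀ m : ℕ, m ≤ n → (m : ℝ) / n ∈ Icc (0 : ℝ) 1 := fun m hm =>
    ⟨by positivity, div_le_one_of_le₀ (by exact_mod_cast hm) (by positivity)⟩
  have hkn := (Finset.mem_Icc.1 hk).2
  have hle : k - (j - i) ≤ k := Nat.sub_le _ _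
  refine hfmono (hunit _ (hle.trans hkn)) (hunit _ hkn) ?_
  gcongr
end
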